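/- Let X be a nonnegative random variable whose CDF F is continuous and strictly increasing on [0,∞) with F(0) = 0. Then E X_{i:n} = F^{-1}(i/n) for every n ≥ 2 and every 1 ≤ i ≤ n−1 if and only if there exists a scale parameter a > 0 such that F(x) = x/(x+a) for all x ≥ 0 (the log-logistic distribution with shape parameter 1); in that case E X_{i:n} = a·i/(n−i) for 1 ≤ i ≤ n−1. -/

import Mathlib

open MeasureTheory Set Filter

/-- Generalized inverse (quantile function) `F⁻¹(p) = inf {x | p ≤ F x}` of a CDF `F`. -/
noncomputable def qf (F : ℝ → ℝ) (p : ℝ) : ℝ := sInf {x | p ≤ F x}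

/-- `F` is a cumulative distribution function: monotone, right-continuous, with limits
`0` at `-∞` and `1` at `+∞`. -/
def IsCDF (F : ℝ → ℝ) : Prop :=
  Monotone F ∧ (∀ x, ContinuousWithinAt F (Set.Ici x) x) ∧
    Tendsto F atBot (nhds 0) ∧ Tendsto F atTop (nhds 1)

/-- The (real) Beta function `B(a,b) = ∫₀¹ t^(a-1) (1-t)^(b-1) dt`. -/
noncomputable def Bfun (a b : ℝ) : ℝ :=
  ∫ t in Set.Ioo (0:ℝ) 1, t ^ (a - 1) * (1 - t) ^ (b - 1)

/-- The Beta(i, n-i+1) distribution on `ℝ`, i.e. the law of the `i`-th order statistic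
`B_{i:n}` of an i.i.d. uniform sample of size `n`. -/
noncomputable def betaLaw (i n : ℕ) : Measure ℝ :=
  (volume.restrict (Set.Ioo (0:ℝ) 1)).withDensity fun t =>
    ENNReal.ofReal (t ^ ((i:ℝ) - 1) * (1 - t) ^ ((n:ℝ) - (i:ℝ)) / Bfun (i:ℝ) ((n:ℝ) - (i:ℝ) + 1))

/-- The law of the `i`-th order statistic `X_{i:n}` of an i.i.d. sample of size `n` from the
CDF `F`: the pushforward of the Beta(i, n-i+1) measure under the quantile function `F⁻¹`. -/
noncomputable def osLaw (F : ℝ → ℝ) (i n : ℕ) : Measure ℝ := (betaLaw i n).map (qf F)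

/-- The `k`-th harmonic number `H_k = ∑_{r=1}^k 1/r`. -/
noncomputable def harm (k : ℕ) : ℝ := ∑ r ∈ Finset.Icc 1 k, (1:ℝ) / r


lemma Bfun_eq (a b : ℝ) (ha : 0 < a) (hb : 0 < b) : Bfun a b = ProbabilityTheory.beta a b := by
  rw [ProbabilityTheory.beta_eq_betaIntegralReal a b ha hb, Complex.betaIntegral, Bfun,
    intervalIntegral.integral_of_le (by norm_num), ← integral_Ioc_eq_integral_Ioo]
  have : ∫ x in Ioc (0:ℝ) 1, ((x:ℂ) ^ ((a:ℂ) - 1) * (1 - (x:ℂ)) ^ ((b:ℂ) - 1)) =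
      ∫ x in Ioc (0:ℝ) 1, ((x ^ (a - 1) * (1 - x) ^ (b - 1) : ℝ) : ℂ) := by
    apply setIntegral_congr_fun measurableSet_Ioc
    intro x hx
    simp only
    push_cast
    rw [Complex.ofReal_cpow hx.1.le, Complex.ofReal_cpow (by linarith [hx.2])]
    push_cast
    rfl
  rw [this, integral_complex_ofReal, Complex.ofReal_re]

lemma Bfun_pos (a b : ℝ) (ha : 0 < a) (hb : 0 < b) : 0 < Bfun a b := by
  rw [Bfun_eq a b ha hb]; exact ProbabilityTheory.beta_pos ha hb

lemma Bfun_left (a b : ℝ) (ha : 0 < a) (hb : 0 < b) :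
    (a + b) * Bfun (a + 1) b = a * Bfun a b := by
  rw [Bfun_eq a b ha hb, Bfun_eq _ b (by linarith) hb, ProbabilityTheory.beta,
    ProbabilityTheory.beta, Real.Gamma_add_one ha.ne', show a + 1 + b = (a + b) + 1 by ring,
    Real.Gamma_add_one (by linarith)]
  have := (Real.Gamma_pos_of_pos (add_pos ha hb)).ne'
  have : a + b ≠ 0 := by linarith
  field_simp

lemma Bfun_right (a b : ℝ) (ha : 0 < a) (hb : 0 < b) :
    (a + b) * Bfun a (b + 1) = b * Bfun a b := by
  rw [Bfun_eq a b ha hb, Bfun_eq a _ ha (by linarith), ProbabilityTheory.beta,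
    ProbabilityTheory.beta, Real.Gamma_add_one hb.ne', show a + (b + 1) = (a + b) + 1 by ring,
    Real.Gamma_add_one (by linarith)]
  have := (Real.Gamma_pos_of_pos (add_pos ha hb)).ne'
  have : a + b ≠ 0 := by linarith
  field_simp

noncomputable def dens (i n : ℕ) (t : ℝ) : ℝ :=
  t ^ ((i:ℝ) - 1) * (1 - t) ^ ((n:ℝ) - (i:ℝ)) / Bfun (i:ℝ) ((n:ℝ) - (i:ℝ) + 1)

lemma dens_nonneg (i n : ℕ) (hi : 1 ≤ i) (hn : i ≤ n) (t : ℝ) (ht : t ∈ Ioo (0:ℝ) 1) :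
    0 ≤ dens i n t := by
  have h1 : (0:ℝ) < i := by exact_mod_cast hi
  have h2 : (i:ℝ) ≤ n := by exact_mod_cast hn
  have := Bfun_pos (i:ℝ) ((n:ℝ) - (i:ℝ) + 1) h1 (by linarith)
  have h3 : 0 ≤ t := ht.1.le
  have h4 : 0 ≤ 1 - t := by linarith [ht.2]
  unfold dens
  positivity

lemma integral_betaLaw (i n : ℕ) (hi : 1 ≤ i) (hn : i ≤ n) (f : ℝ → ℝ) :
    ∫ p, f p ∂(betaLaw i n) = ∫ t in Ioo (0:ℝ) 1, dens i n t * f t := by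
  rw [betaLaw, integral_withDensity_eq_integral_toReal_smul (by fun_prop) (by simp)]
  apply setIntegral_congr_fun measurableSet_Ioo
  intro t ht
  change (ENNReal.ofReal (dens i n t)).toReal * f t = _
  rw [ENNReal.toReal_ofReal (dens_nonneg i n hi hn t ht)]

lemma integrable_betaLaw (i n : ℕ) (hi : 1 ≤ i) (hn : i ≤ n) (f : ℝ → ℝ)
    (h : Integrable f (betaLaw i n)) : IntegrableOn (fun t => dens i n t * f t) (Ioo (0:ℝ) 1) := by
  rw [betaLaw, integrable_withDensity_iff_integrable_smul' (by fun_prop) (by simp)] at h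
  refine IntegrableOn.congr_fun h ?_ measurableSet_Ioo
  intro t ht
  change (ENNReal.ofReal (dens i n t)).toReal * f t = _
  rw [ENNReal.toReal_ofReal (dens_nonneg i n hi hn t ht)]

lemma dens_rec (m i : ℕ) (hi : 1 ≤ i) (him : i ≤ m) (t : ℝ) (ht : t ∈ Ioo (0:ℝ) 1) :
    ((m:ℝ) + 1) * dens i m t =
      ((m:ℝ) + 1 - i) * dens i (m + 1) t + i * dens (i + 1) (m + 1) t := by
  have h1 : (0:ℝ) < i := by exact_mod_cast hi
  have h2 : (i:ℝ) ≤ m := by exact_mod_cast him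
  have hb : (0:ℝ) < (m:ℝ) - i + 1 := by linarith
  have hB := Bfun_pos (i:ℝ) ((m:ℝ) - i + 1) h1 hb
  have hL := Bfun_left (i:ℝ) ((m:ℝ) - i + 1) h1 hb
  have hR := Bfun_right (i:ℝ) ((m:ℝ) - i + 1) h1 hb
  unfold dens
  push_cast
  have e1 : (m:ℝ) + 1 - i + 1 = (m:ℝ) - i + 1 + 1 := by ring
  have e2 : (m:ℝ) + 1 - (i + 1) + 1 = (m:ℝ) - i + 1 := by ring
  have e3 : (i:ℝ) + ((m:ℝ) - i + 1) = m + 1 := by ring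
  rw [e3] at hL hR
  have hm : (0:ℝ) < (m:ℝ) + 1 := by positivity
  have hL' : Bfun ((i:ℝ) + 1) ((m:ℝ) - i + 1) = i * Bfun i ((m:ℝ) - i + 1) / (m + 1) := by
    field_simp; linarith
  have hR' : Bfun (i:ℝ) ((m:ℝ) - i + 1 + 1) = ((m:ℝ) - i + 1) * Bfun i ((m:ℝ) - i + 1) / (m + 1) := by
    field_simp; linarith
  rw [e1, e2, hL', hR']
  have e4 : (m:ℝ) + 1 - i = ((m:ℝ) - i) + 1 := by ring
  have e5 : (m:ℝ) + 1 - (i + 1) = (m:ℝ) - i := by ring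
  have e6 : (i:ℝ) + 1 - 1 = (i - 1) + 1 := by ring
  have ht1 : (0:ℝ) < 1 - t := by linarith [ht.2]
  rw [e4, e5, e6, Real.rpow_add_one ht1.ne', Real.rpow_add_one ht.1.ne']
  field_simp
  ring

lemma mean_rec (f : ℝ → ℝ) (m i : ℕ) (hi : 1 ≤ i) (him : i ≤ m)
    (hA : Integrable f (betaLaw i (m + 1))) (hB : Integrable f (betaLaw (i + 1) (m + 1))) :
    ((m:ℝ) + 1) * ∫ p, f p ∂(betaLaw i m) =
      ((m:ℝ) + 1 - i) * ∫ p, f p ∂(betaLaw i (m + 1)) + i * ∫ p, f p ∂(betaLaw (i + 1) (m + 1)) := by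
  rw [integral_betaLaw i m hi him, integral_betaLaw i (m+1) hi (by omega),
    integral_betaLaw (i+1) (m+1) (by omega) (by omega)]
  have hA' := integrable_betaLaw i (m+1) hi (by omega) f hA
  have hB' := integrable_betaLaw (i+1) (m+1) (by omega) (by omega) f hB
  rw [← integral_const_mul, ← integral_const_mul, ← integral_const_mul,
    ← integral_add (hA'.const_mul _) (hB'.const_mul _)]
  apply setIntegral_congr_fun measurableSet_Ioo
  intro t ht
  have := dens_rec m i hi him t ht
  simp only
  rw [← mul_assoc, this]
  ring

lemma mean_loglog (f : ℝ → ℝ) (a : ℝ) (hf : ∀ t ∈ Ioo (0:ℝ) 1, f t = a * t / (1 - t))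
    (n i : ℕ) (hi : 1 ≤ i) (hin : i + 1 ≤ n) :
    ∫ p, f p ∂(betaLaw i n) = a * (i:ℝ) / ((n:ℝ) - (i:ℝ)) := by
  have h1 : (0:ℝ) < i := by exact_mod_cast hi
  have h2 : (i:ℝ) + 1 ≤ n := by exact_mod_cast hin
  have h3 : (0:ℝ) < (n:ℝ) - i := by linarith
  rw [integral_betaLaw i n hi (by omega)]
  have hL := Bfun_left (i:ℝ) ((n:ℝ) - i) h1 h3
  have hR := Bfun_right (i:ℝ) ((n:ℝ) - i) h1 h3
  have hB := Bfun_pos (i:ℝ) ((n:ℝ) - i) h1 h3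
  have hB1 := Bfun_pos (i:ℝ) ((n:ℝ) - i + 1) h1 (by linarith)
  have e : ∫ t in Ioo (0:ℝ) 1, dens i n t * f t =
      ∫ t in Ioo (0:ℝ) 1, (a / Bfun (i:ℝ) ((n:ℝ) - i + 1)) *
        (t ^ ((i:ℝ) + 1 - 1) * (1 - t) ^ ((n:ℝ) - i - 1)) := by
    apply setIntegral_congr_fun measurableSet_Ioo
    intro t ht
    have ht1 : (0:ℝ) < 1 - t := by linarith [ht.2]
    simp only
    rw [hf t ht, dens, show (i:ℝ) + 1 - 1 = (i - 1) + 1 by ring, Real.rpow_add_one ht.1.ne',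
      Real.rpow_sub_one ht1.ne' ((n:ℝ) - i)]
    field_simp
  rw [e, integral_const_mul, ← Bfun]
  have hn : (0:ℝ) < (i:ℝ) + (n - i) := by linarith
  have hL' : Bfun ((i:ℝ) + 1) ((n:ℝ) - i) = i * Bfun i ((n:ℝ) - i) / (i + (n - i)) := by
    field_simp; linarith
  have hR' : Bfun (i:ℝ) ((n:ℝ) - i + 1) = ((n:ℝ) - i) * Bfun i ((n:ℝ) - i) / (i + (n - i)) := by
    field_simp; linarith
  rw [hL', hR']
  field_simp


lemma approx_right (p : ℝ) (N : ℕ) (hN : 0 < N) (δ : ℝ) (hδ : 0 < δ) :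
    ∃ (m : ℕ) (i : ℤ), N ≤ m ∧ 0 ≤ (i:ℝ) - m * p ∧ (i:ℝ) - m * p ≤ δ := by
  obtain ⟨n, hn⟩ := exists_nat_gt (1 / δ)
  have hn0 : 0 < n := by
    have : (0:ℝ) < n := lt_trans (by positivity) hn
    exact_mod_cast this
  obtain ⟨k, hk0, hkn, hk⟩ := Real.exists_nat_abs_mul_sub_round_le ((N:ℝ) * p) hn0
  set r : ℤ := round ((k:ℝ) * ((N:ℝ) * p)) with hr
  have hb : (1:ℝ) / (n + 1) ≤ δ := by
    rw [div_le_iff₀ (by positivity)]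
    rw [div_lt_iff₀ hδ] at hn
    nlinarith
  have hk' := hk.trans hb
  rw [abs_le] at hk'
  by_cases hs : 0 < (k:ℝ) * ((N:ℝ) * p) - r
  · set s := (k:ℝ) * ((N:ℝ) * p) - r with hsdef
    have hs2 : s ≤ 1/2 := (le_abs_self s).trans (abs_sub_round _)
    set t := ⌊1 / s⌋₊ with ht
    have h1 : (t:ℝ) ≤ 1 / s := Nat.floor_le (by positivity)
    have h2 : 1 / s < t + 1 := Nat.lt_floor_add_one _
    rw [le_div_iff₀ hs] at h1
    rw [div_lt_iff₀ hs] at h2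
    have ht1 : 1 ≤ t := by
      rw [ht]; apply Nat.le_floor; rw [le_div_iff₀ hs]; push_cast; linarith
    refine ⟨t * k * N, t * r + 1, ?_, ?_, ?_⟩
    · have : 1 ≤ t * k := Nat.mul_pos ht1 hk0
      nlinarith
    · have : (((t * r + 1 : ℤ)):ℝ) - ((t * k * N : ℕ):ℝ) * p = 1 - t * s := by
        rw [hsdef]; push_cast; ring
      rw [this]; linarith
    · have : (((t * r + 1 : ℤ)):ℝ) - ((t * k * N : ℕ):ℝ) * p = 1 - t * s := by
        rw [hsdef]; push_cast; ring
      rw [this]; linarith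
  · refine ⟨k * N, r, by nlinarith, ?_, ?_⟩ <;> push_cast <;> nlinarith

lemma step_bound (H : ℝ → ℝ) (α β M s : ℝ) (N : ℕ)
    (hrec : ∀ m i : ℕ, 1 ≤ i → i + 1 ≤ m →
      (m:ℝ) * H (i / m) = ((m:ℝ) - i) * H (i / ((m:ℝ) + 1)) + i * H (((i:ℝ) + 1) / ((m:ℝ) + 1)))
    (hM : ∀ x, α ≤ x → x ≤ β → H x - s * (N / ((N:ℝ) + 1)) * (x * (1 - x)) ≤ M) (j : ℕ) :
    ∀ m i : ℕ, m + j = N → 1 ≤ i → i + 1 ≤ m → α ≤ (i:ℝ) / N → ((i:ℝ) + j) / N ≤ β →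
      H (i / m) - s * (m / ((m:ℝ) + 1)) * ((i / m : ℝ) * (1 - (i / m : ℝ))) ≤ M := by
  induction j with
  | zero =>
    intro m i hm hi him h1 h2
    simp only [Nat.add_zero] at hm
    subst hm
    exact hM _ h1 (by simpa using h2)
  | succ j ih =>
    intro m i hm hi him h1 h2
    have hNpos : (0:ℝ) < N := by
      have : 0 < N := by omega
      exact_mod_cast this
    have hA := ih (m + 1) i (by omega) hi (by omega) h1
      (le_trans (by gcongr; push_cast; linarith) h2)
    have hB := ih (m + 1) (i + 1) (by omega) (by omega) (by omega)
      (le_trans h1 (by gcongr; push_cast; linarith))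
      (le_trans (le_of_eq (by push_cast; ring)) h2)
    have hr := hrec m i hi him
    have hmpos : (0:ℝ) < m := by
      have : 0 < m := by omega
      exact_mod_cast this
    have hipos : (0:ℝ) ≤ i := by positivity
    have himr : (0:ℝ) ≤ (m:ℝ) - i := by
      have : (i:ℝ) + 1 ≤ m := by exact_mod_cast him
      linarith
    push_cast at hA hB
    have e1 := mul_le_mul_of_nonneg_left hA himr
    have e2 := mul_le_mul_of_nonneg_left hB hipos
    have e3 : (m:ℝ) * (s * (m / ((m:ℝ) + 1)) * ((i / m : ℝ) * (1 - (i / m : ℝ)))) =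
       ((m:ℝ) - i) * (s * (((m:ℝ) + 1) / ((m:ℝ) + 1 + 1)) * ((i / ((m:ℝ)+1) : ℝ) * (1 - (i / ((m:ℝ)+1) : ℝ)))) + i * (s * (((m:ℝ) + 1) / ((m:ℝ) + 1 + 1)) * ((((i:ℝ)+1) / ((m:ℝ)+1) : ℝ) * (1 - (((i:ℝ)+1) / ((m:ℝ)+1) : ℝ)))) := by
      field_simp
      ring
    have : (m:ℝ) * (H (i / m) - s * (m / ((m:ℝ) + 1)) * ((i / m : ℝ) * (1 - (i / m : ℝ)))) ≤ m * M := by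
      rw [mul_sub, hr, e3]
      linarith
    exact le_of_mul_le_mul_left this hmpos

set_option maxHeartbeats 1000000 in
lemma max_principle (H : ℝ → ℝ) (α β C : ℝ) (hα : 0 < α) (hβ : β < 1) (hC : 0 ≤ C)
    (hcont : ContinuousOn H (Icc α β))
    (hrec : ∀ m i : ℕ, 1 ≤ i → i + 1 ≤ m →
      (m:ℝ) * H (i / m) = ((m:ℝ) - i) * H (i / ((m:ℝ) + 1)) + i * H (((i:ℝ) + 1) / ((m:ℝ) + 1)))
    (hone : ∀ p q, α ≤ p → p ≤ q → q ≤ β → H p - C * (q - p) ≤ H q)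
    (hHα : H α ≤ 0) (hHβ : H β ≤ 0) (p0 : ℝ) (hp0 : p0 ∈ Icc α β) : H p0 ≤ 0 := by
  by_contra! hpos
  obtain ⟨hp1, hp2⟩ := hp0
  set ε := H p0 with hε
  obtain ⟨p, ⟨hpα, hpβ⟩, hmax⟩ := isCompact_Icc.exists_isMaxOn (f := fun x => H x - ε * (x * (1 - x)))
    (nonempty_Icc.2 (hp1.trans hp2)) (by fun_prop)
  set M := H p - ε * (p * (1 - p)) with hMdef
  have hM : ∀ x, α ≤ x → x ≤ β → H x - ε * (x * (1 - x)) ≤ M := fun x h1 h2 => hmax ⟨h1, h2⟩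
  have hMpos : 0 < M := by
    have := hM p0 hp1 hp2
    have : p0 * (1 - p0) < 1 := by nlinarith [sq_nonneg (p0 - 1/2)]
    nlinarith
  have hpα' : α < p := by
    rcases hpα.lt_or_eq with h | h
    · exact h
    · exfalso
      subst h
      have : 0 < α * (1 - α) := by apply mul_pos <;> linarith
      nlinarith
  have hpβ' : p < β := by
    rcases hpβ.lt_or_eq with h | h
    · exact h
    · exfalso
      subst h
      have : 0 < p * (1 - p) := by apply mul_pos <;> linarith
      nlinarith
  obtain ⟨θ, hθ0, hθ1, hθ2⟩ : ∃ θ : ℝ, 0 < θ ∧ θ ≤ p - α ∧ θ ≤ (β - p) / 2 :=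
    ⟨min (p - α) ((β - p)/2), lt_min (by linarith) (by linarith), min_le_left _ _, min_le_right _ _⟩
  have hφ0 : 0 < α * (1 - β) := mul_pos hα (by linarith)
  obtain ⟨δ, hδ0, hδ1, hδ2⟩ : ∃ δ : ℝ, 0 < δ ∧ δ ≤ 1 ∧ (C + ε) * δ < ε * θ * (α * (1 - β)) / 8 := by
    refine ⟨min 1 (ε * θ * (α * (1 - β)) / 16 / (C + ε)), by positivity, min_le_left _ _, ?_⟩
    have h1 : min 1 (ε * θ * (α * (1 - β)) / 16 / (C + ε)) ≤ (ε * θ * (α * (1 - β)) / 16 / (C + ε)) := min_le_right _ _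
    rw [le_div_iff₀ (by positivity)] at h1
    have : 0 < ε * θ * (α * (1 - β)) := by positivity
    linarith
  obtain ⟨N, hN⟩ := exists_nat_gt (2 / θ)
  have hN0 : 0 < N := by
    have : (0:ℝ) < N := lt_trans (by positivity) hN
    exact_mod_cast this
  obtain ⟨m, i', hmN, hi0, hi1⟩ := approx_right p N hN0 δ hδ0
  have hm1 : (1:ℝ) ≤ m := by
    have : 1 ≤ m := by omega
    exact_mod_cast this
  have hmθ : 2 < θ * m := by
    have : (N:ℝ) ≤ m := by exact_mod_cast hmN
    rw [div_lt_iff₀ hθ0] at hN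
    nlinarith
  have hi'pos : 0 < i' := by
    have : (0:ℝ) < i' := by nlinarith
    exact_mod_cast this
  lift i' to ℕ using hi'pos.le with i
  simp only [Int.cast_natCast] at hi0 hi1
  have hi1' : 1 ≤ i := by omega
  have hiβ : (i:ℝ) + θ * m ≤ β * m := by nlinarith
  have him : i + 1 ≤ m := by
    have : (i:ℝ) < m := by nlinarith
    have : i < m := by exact_mod_cast this
    omega
  set k := ⌊θ * m⌋₊ with hk
  have hk1 : (k:ℝ) ≤ θ * m := Nat.floor_le (by positivity)
  have hk2 : θ * m < k + 1 := Nat.lt_floor_add_one _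
  have hmpos : (0:ℝ) < m := by linarith
  have hkm : (k:ℝ) ≤ m := by nlinarith
  have hkpos : θ * m / 2 ≤ k := by linarith
  set n := m + k with hn
  have hnr : (n:ℝ) = m + k := by rw [hn]; push_cast; ring
  have hnpos : (0:ℝ) < n := by rw [hnr]; positivity
  have hαk : α * k ≤ k := mul_le_of_le_one_left (Nat.cast_nonneg k) (by linarith)
  have hβk : 0 ≤ β * k := mul_nonneg (by linarith) (Nat.cast_nonneg k)
  have hθ1m : θ * m ≤ (p - α) * m := mul_le_mul_of_nonneg_right hθ1 hmpos.le
  have hlo : α * (m + k) ≤ (i:ℝ) := by linarith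
  have hhi : (i:ℝ) + k ≤ β * (m + k) := by linarith
  have key := step_bound H α β M (ε * ((n + 1) / n)) n hrec (by
    intro x h1 h2
    have : ε * (((n:ℝ) + 1) / n) * (n / ((n:ℝ) + 1)) = ε := by field_simp
    rw [this]; exact hM x h1 h2) k m i rfl hi1' him
    (by rw [le_div_iff₀ hnpos, hnr]; exact hlo)
    (by rw [div_le_iff₀ hnpos, hnr]; exact hhi)
  set q : ℝ := i / m with hq
  have hqm : q * m = i := by rw [hq]; field_simp
  have hpq : p ≤ q := by rw [hq, le_div_iff₀ hmpos]; linarith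
  have hqβ : q ≤ β := by rw [hq, div_le_iff₀ hmpos]; nlinarith
  have h1 := hone p q hpα hpq hqβ
  have hc : ε * (((n:ℝ) + 1) / n) * (m / ((m:ℝ) + 1)) = ε * (1 - k / ((m + 1) * (m + k))) := by
    rw [hnr]; field_simp; ring
  rw [hc] at key
  have hlow : θ / (8 * m) ≤ k / (((m:ℝ) + 1) * (m + k)) := by
    rw [div_le_div_iff₀ (by positivity) (by positivity)]
    have : ((m:ℝ) + 1) * (m + k) ≤ (2 * m) * (2 * m) := by
      apply mul_le_mul <;> first | positivity | linarith
    nlinarith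
  have hφq : α * (1 - β) ≤ q * (1 - q) := by
    apply mul_le_mul <;> linarith
  have hprod : θ / (8 * m) * (α * (1 - β)) ≤ k / (((m:ℝ) + 1) * (m + k)) * (q * (1 - q)) := by
    apply mul_le_mul hlow hφq hφ0.le (by positivity)
  have hφd : q * (1 - q) - p * (1 - p) ≤ q - p := by nlinarith
  have hfin : ε * (θ / (8 * m) * (α * (1 - β))) ≤ (C + ε) * (q - p) := by nlinarith
  have hfin2 := mul_le_mul_of_nonneg_right hfin hmpos.le
  have e1 : ε * (θ / (8 * m) * (α * (1 - β))) * m = ε * θ * (α * (1 - β)) / 8 := by field_simp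
  have e2 : (C + ε) * (q - p) * m ≤ (C + ε) * δ := by
    rw [mul_assoc]
    apply mul_le_mul_of_nonneg_left _ (by positivity)
    nlinarith
  linarith

lemma chord_le (G : ℝ → ℝ) (α β C : ℝ) (hα : 0 < α) (hab : α < β) (hβ : β < 1) (hC : 0 ≤ C)
    (hcont : ContinuousOn G (Icc α β))
    (hrec : ∀ m i : ℕ, 1 ≤ i → i + 1 ≤ m →
      (m:ℝ) * G (i / m) = ((m:ℝ) - i) * G (i / ((m:ℝ) + 1)) + i * G (((i:ℝ) + 1) / ((m:ℝ) + 1)))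
    (hone : ∀ p q, α ≤ p → p ≤ q → q ≤ β → G p - C * (q - p) ≤ G q)
    (p : ℝ) (hp : p ∈ Icc α β) : (β - α) * G p ≤ (β - p) * G α + (p - α) * G β := by
  set A := (G β - G α) / (β - α) with hA
  have hba : 0 < β - α := by linarith
  have hA' : A * (β - α) = G β - G α := by rw [hA]; field_simp
  have := max_principle (fun x => G x - (G α + A * (x - α))) α β (C + |A|) hα hβ (by positivity)
    (by fun_prop) (by
      intro m i h1 h2
      have hm : (0:ℝ) < m := by
        have : 0 < m := by omega
        exact_mod_cast this
      rw [mul_sub, hrec m i h1 h2]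
      field_simp
      ring) (by
      intro x y h1 h2 h3
      have := hone x y h1 h2 h3
      have := neg_abs_le A
      have := le_abs_self A
      nlinarith) (by simp) (by linarith) p hp
  have h2 := mul_le_mul_of_nonneg_left this hba.le
  have h3 : A * (β - α) * (p - α) = (G β - G α) * (p - α) := by rw [hA']
  linarith

lemma affine_of_rec (G : ℝ → ℝ) (hcont : ContinuousOn G (Ioo 0 1))
    (hrec : ∀ m i : ℕ, 1 ≤ i → i + 1 ≤ m →
      (m:ℝ) * G (i / m) = ((m:ℝ) - i) * G (i / ((m:ℝ) + 1)) + i * G (((i:ℝ) + 1) / ((m:ℝ) + 1)))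
    (hone : ∀ β, 0 < β → β < 1 → ∃ C, 0 ≤ C ∧
      ∀ p q, 0 < p → p ≤ q → q ≤ β → G p - C * (q - p) ≤ G q) :
    ∃ c d : ℝ, ∀ p ∈ Ioo (0:ℝ) 1, G p = c + d * p := by
  have key : ∀ α p β, 0 < α → α < p → p < β → β < 1 →
      (β - α) * G p = (β - p) * G α + (p - α) * G β := by
    intro α p β h1 h2 h3 h4
    obtain ⟨C, hC, hC'⟩ := hone β (by linarith) h4
    have hsub : Icc α β ⊆ Ioo (0:ℝ) 1 := fun x hx => ⟨h1.trans_le hx.1, hx.2.trans_lt h4⟩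
    apply le_antisymm
    · exact chord_le G α β C h1 (by linarith) h4 hC (hcont.mono hsub) hrec
        (fun x y hx hxy hy => hC' x y (by linarith) hxy hy) p ⟨h2.le, h3.le⟩
    · have := chord_le (fun x => - G (1 - x)) (1 - β) (1 - α) C (by linarith) (by linarith)
        (by linarith) hC (by
          apply ContinuousOn.neg
          apply hcont.comp (by fun_prop)
          intro x hx
          exact ⟨by linarith [hx.2], by linarith [hx.1]⟩) (by
          intro m i hi him
          have hm : (0:ℝ) < m := by
            have : 0 < m := by omega
            exact_mod_cast this
          have := hrec m (m - i) (by omega) (by omega)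
          rw [Nat.cast_sub (by omega)] at this
          have e1 : (1:ℝ) - i / m = ((m:ℝ) - i) / m := by field_simp
          have e2 : (1:ℝ) - i / ((m:ℝ) + 1) = ((m:ℝ) - i + 1) / ((m:ℝ) + 1) := by field_simp; ring
          have e3 : (1:ℝ) - ((i:ℝ) + 1) / ((m:ℝ) + 1) = ((m:ℝ) - i) / ((m:ℝ) + 1) := by field_simp; ring
          rw [e1, e2, e3]
          linarith) (by
          intro x y hx hxy hy
          have := hC' (1 - y) (1 - x) (by linarith) (by linarith) (by linarith)
          linarith) (1 - p) ⟨by linarith, by linarith⟩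
      simp only [sub_sub_cancel] at this
      linarith
  refine ⟨2 * G (1/3) - G (2/3), 3 * (G (2/3) - G (1/3)), ?_⟩
  intro p ⟨h0, h1⟩
  rcases lt_trichotomy p (1/3) with h | h | h
  · have := key p (1/3) (2/3) h0 h (by norm_num) (by norm_num)
    linarith
  · subst h; ring
  · rcases lt_trichotomy p (2/3) with h' | h' | h'
    · have := key (1/3) p (2/3) (by norm_num) h h' (by norm_num)
      linarith
    · subst h'; ring
    · have := key (1/3) (2/3) p (by norm_num) (by norm_num) h' h1
      linarith

/-- For a nonnegative random variable with continuous CDF `F`, strictly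
increasing on `[0,∞)` with `F(0) = 0`: `E X_{i:n} = F⁻¹(i/n)` for all `n ≥ 2` and
`1 ≤ i ≤ n-1` iff `F` is log-logistic with shape parameter `1`, i.e. `F(x) = x/(x+a)` for
some scale `a > 0`; and in that case `E X_{i:n} = a·i/(n-i)`. -/
theorem stmt18 (F : ℝ → ℝ) (hF : IsCDF F) (hFcont : Continuous F)
    (hFmono : StrictMonoOn F (Set.Ici (0:ℝ))) (hF0 : F 0 = 0)
    (hFneg : ∀ x : ℝ, x ≤ 0 → F x = 0)
    (hfin : ∀ n i : ℕ, 1 ≤ i → i ≤ n - 1 → MeasureTheory.Integrable (qf F) (betaLaw i n)) :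
    ((∀ n : ℕ, 2 ≤ n → ∀ i : ℕ, 1 ≤ i → i ≤ n - 1 →
        ∫ p, qf F p ∂(betaLaw i n) = qf F ((i:ℝ) / (n:ℝ))) ↔
      ∃ a : ℝ, 0 < a ∧ ∀ x : ℝ, 0 ≤ x → F x = x / (x + a)) ∧
    (∀ a : ℝ, 0 < a → (∀ x : ℝ, 0 ≤ x → F x = x / (x + a)) →
      ∀ n : ℕ, 2 ≤ n → ∀ i : ℕ, 1 ≤ i → i ≤ n - 1 →
        ∫ p, qf F p ∂(betaLaw i n) = a * (i:ℝ) / ((n:ℝ) - (i:ℝ))) := by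
  obtain ⟨hmono, -, -, htop⟩ := hF
  have hFlt : ∀ x, F x ≤ 1 := fun x => hmono.ge_of_tendsto htop x
  have hF1 : ∀ x, 0 < x → F x ∈ Ioo (0:ℝ) 1 := by
    intro x hx
    refine ⟨?_, ?_⟩
    · rw [← hF0]; exact hFmono (mem_Ici.2 le_rfl) (mem_Ici.2 hx.le) hx
    · exact (hFmono (mem_Ici.2 hx.le) (mem_Ici.2 (by linarith)) (lt_add_one x)).trans_le (hFlt _)
  have hQF : ∀ x, 0 < x → qf F (F x) = x := by
    intro x hx
    have : {y | F x ≤ F y} = Ici x := by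
      ext y
      simp only [mem_setOf_eq, mem_Ici]
      constructor
      · intro h
        by_contra! hlt
        rcases le_or_gt y 0 with h0 | h0
        · rw [hFneg y h0] at h
          exact absurd (hF1 x hx).1 (not_lt.2 h)
        · exact absurd (hFmono (mem_Ici.2 h0.le) (mem_Ici.2 hx.le) hlt) (not_lt.2 h)
      · intro h; exact hmono h
    rw [qf, this, csInf_Ici]
  have hsurj : ∀ p ∈ Ioo (0:ℝ) 1, ∃ x, 0 < x ∧ F x = p := by
    intro p ⟨h0, h1⟩
    obtain ⟨b, hb1, hb0⟩ := ((htop.eventually (lt_mem_nhds h1)).and (eventually_gt_atTop 0)).exists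
    obtain ⟨x, hx, hxp⟩ := intermediate_value_Icc hb0.le hFcont.continuousOn
      (show p ∈ Icc (F 0) (F b) from ⟨by rw [hF0]; exact h0.le, hb1.le⟩)
    refine ⟨x, ?_, hxp⟩
    rcases hx.1.lt_or_eq with h | h
    · exact h
    · exfalso
      rw [← h, hF0] at hxp
      linarith
  have hsecond : ∀ a : ℝ, 0 < a → (∀ x : ℝ, 0 ≤ x → F x = x / (x + a)) →
      ∀ t ∈ Ioo (0:ℝ) 1, qf F t = a * t / (1 - t) := by
    intro a ha hFa t ht
    obtain ⟨x, hx, rfl⟩ := hsurj t ht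
    rw [hQF x hx, hFa x hx.le]
    have : 0 < x + a := by linarith
    have e : 1 - x / (x + a) = a / (x + a) := by field_simp; ring
    rw [e]
    field_simp
  refine ⟨⟨?_, ?_⟩, ?_⟩
  · intro hE
    have hQpos : ∀ p ∈ Ioo (0:ℝ) 1, 0 < qf F p := by
      intro p hp
      obtain ⟨x, hx, rfl⟩ := hsurj p hp
      rw [hQF x hx]; exact hx
    have hQmono : MonotoneOn (qf F) (Ioo (0:ℝ) 1) := by
      intro p hp q hq hpq
      obtain ⟨x, hx, rfl⟩ := hsurj p hp
      obtain ⟨y, hy, rfl⟩ := hsurj q hq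
      rw [hQF x hx, hQF y hy]
      by_contra! hlt
      exact absurd (hFmono (mem_Ici.2 hy.le) (mem_Ici.2 hx.le) hlt) (not_lt.2 hpq)
    have hQcont : ContinuousOn (qf F) (Ioo (0:ℝ) 1) := by
      intro p hp
      apply ContinuousAt.continuousWithinAt
      apply continuousAt_of_monotoneOn_of_image_mem_nhds hQmono (isOpen_Ioo.mem_nhds hp)
      refine mem_of_superset (isOpen_Ioi.mem_nhds (show qf F p ∈ Ioi (0:ℝ) from hQpos p hp)) ?_
      intro x hx
      exact ⟨F x, hF1 x hx, hQF x hx⟩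
    obtain ⟨c, d, hcd⟩ := affine_of_rec (fun p => (1 - p) * qf F p)
      (by fun_prop) (by
        intro m i hi him
        have h1 := mean_rec (qf F) m i hi (by omega) (hfin (m+1) i hi (by omega))
          (hfin (m+1) (i+1) (by omega) (by omega))
        rw [hE m (by omega) i hi (by omega), hE (m+1) (by omega) i hi (by omega),
          hE (m+1) (by omega) (i+1) (by omega) (by omega)] at h1
        push_cast at h1
        have hm : (0:ℝ) < m := by
          have : 0 < m := by omega
          exact_mod_cast this
        have e1 : (m:ℝ) * ((1 - i / m) * qf F (i / m)) = ((m:ℝ) - i) * qf F (i / m) := by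
          field_simp
        have e2 : (1:ℝ) - i / ((m:ℝ) + 1) = ((m:ℝ) + 1 - i) / ((m:ℝ) + 1) := by field_simp
        have e3 : (1:ℝ) - ((i:ℝ) + 1) / ((m:ℝ) + 1) = ((m:ℝ) - i) / ((m:ℝ) + 1) := by
          field_simp; ring
        rw [e1, e2, e3]
        have e4 : qf F (i / m) = (((m:ℝ) + 1 - i) * qf F (i / ((m:ℝ) + 1)) +
            i * qf F (((i:ℝ) + 1) / ((m:ℝ) + 1))) / ((m:ℝ) + 1) := by
          rw [← h1]; field_simp
        rw [e4]
        ring) (by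
        intro β h0 h1
        refine ⟨qf F β, (hQpos β ⟨h0, h1⟩).le, ?_⟩
        intro p q hp hpq hq
        have hpm : p ∈ Ioo (0:ℝ) 1 := ⟨hp, by linarith⟩
        have hqm : q ∈ Ioo (0:ℝ) 1 := ⟨by linarith, by linarith⟩
        have i1 := hQmono hpm hqm hpq
        have i2 := hQmono hpm ⟨h0, h1⟩ (hpq.trans hq)
        have i3 := mul_le_mul_of_nonneg_left i1 (show 0 ≤ 1 - q by linarith)
        have i4 := mul_le_mul_of_nonneg_right i2 (show 0 ≤ q - p by linarith)
        linarith)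
    have hx : ∀ x, 0 < x → (1 - F x) * x = c + d * F x := by
      intro x hx
      have := hcd (F x) (hF1 x hx)
      rwa [hQF x hx] at this
    have hc : c = 0 := by
      have t1 : Tendsto (fun x => (1 - F x) * x) (nhdsWithin 0 (Ioi 0)) (nhds ((1 - F 0) * 0)) :=
        (Continuous.tendsto (by fun_prop) 0).mono_left nhdsWithin_le_nhds
      have t2 : Tendsto (fun x => c + d * F x) (nhdsWithin 0 (Ioi 0)) (nhds (c + d * F 0)) :=
        (Continuous.tendsto (by fun_prop) 0).mono_left nhdsWithin_le_nhds
      have t3 := t1.congr' (eventually_nhdsWithin_of_forall fun x h => hx x h)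
      have := tendsto_nhds_unique t2 t3
      rw [hF0] at this
      linarith
    have hd : 0 < d := by
      have h1 := hx 1 one_pos
      have h2 := hF1 1 one_pos
      have h3 : 0 < d * F 1 := by rw [hc] at h1; linarith [h2.2]
      exact pos_of_mul_pos_left h3 h2.1.le
    refine ⟨d, hd, ?_⟩
    intro x hx0
    rcases hx0.lt_or_eq with h | h
    · rw [eq_div_iff (by linarith)]
      have := hx x h
      rw [hc] at this
      linarith
    · rw [← h, hF0]; simp
  · rintro ⟨a, ha, hFa⟩ n hn i hi hin
    have hQ := hsecond a ha hFa
    have h1 : (0:ℝ) < i := by exact_mod_cast hi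
    have h2 : (i:ℝ) + 1 ≤ n := by
      have : i + 1 ≤ n := by omega
      exact_mod_cast this
    have h3 : (0:ℝ) < n := by linarith
    rw [mean_loglog (qf F) a hQ n i hi (by omega), hQ (i / n) ⟨by positivity, by
      rw [div_lt_one h3]; linarith⟩]
    have h4 : (0:ℝ) < (n:ℝ) - i := by linarith
    have e : (1:ℝ) - i / n = ((n:ℝ) - i) / n := by field_simp
    rw [e]
    field_simp
  · intro a ha hFa n hn i hi hin
    exact mean_loglog (qf F) a (hsecond a ha hFa) n i hi (by omega)
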